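/- There do not exist entire functions α, β : ℂ → ℂ, not both constant, and a nonzero constant c ∈ ℂ, such that α(z)^N − β(z)^M = c for all z ∈ ℂ, when N ≥ 4 and M ≥ 4. -/

import Mathlib

open Filter Topology Complex ComplexConjugate

/-- `f` is differentiable near `0`, with first derivative `p` and second derivative `s` at `0`. -/
def HasTwoJet (f : ℝ → ℝ) (p s : ℝ) : Prop :=
  ∃ f' : ℝ → ℝ, (∀ᶠ t in 𝓝 0, HasDerivAt f (f' t) t) ∧ f' 0 = p ∧ HasDerivAt f' s 0

namespace HasTwoJet

variable {f g : ℝ → ℝ} {p s q r : ℝ}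

lemma add (hf : HasTwoJet f p s) (hg : HasTwoJet g q r) :
    HasTwoJet (fun t => f t + g t) (p + q) (s + r) := by
  obtain ⟨f', h1, rfl, h3⟩ := hf
  obtain ⟨g', k1, rfl, k3⟩ := hg
  exact ⟨fun t => f' t + g' t, by filter_upwards [h1, k1] with t a b using a.add b, rfl,
    h3.add k3⟩

lemma const_mul (a : ℝ) (hf : HasTwoJet f p s) :
    HasTwoJet (fun t => a * f t) (a * p) (a * s) := by
  obtain ⟨f', h1, rfl, h3⟩ := hf
  exact ⟨fun t => a * f' t, by filter_upwards [h1] with t h using h.const_mul a, rfl,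
    h3.const_mul a⟩

lemma const_add (a : ℝ) (hf : HasTwoJet f p s) : HasTwoJet (fun t => a + f t) p s := by
  obtain ⟨f', h1, rfl, h3⟩ := hf
  exact ⟨f', by filter_upwards [h1] with t h using h.const_add a, rfl, h3⟩

lemma log (hf : HasTwoJet f p s) (h0 : f 0 ≠ 0) :
    HasTwoJet (fun t => Real.log (f t)) (p / f 0) (s / f 0 - p ^ 2 / f 0 ^ 2) := by
  obtain ⟨f', h1, rfl, h3⟩ := hf
  have hd : HasDerivAt f (f' 0) 0 := h1.self_of_nhds
  refine ⟨fun t => f' t / f t, ?_, rfl, ?_⟩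
  · filter_upwards [h1, hd.continuousAt.eventually_ne h0] with t h hne using h.log hne
  · have := h3.div hd h0
    rw [show s / f 0 - f' 0 ^ 2 / f 0 ^ 2 = (s * f 0 - f' 0 * f' 0) / f 0 ^ 2 by field_simp]
    exact this

/-- At a local maximum the second derivative is nonpositive. -/
lemma nonpos_of_isLocalMax (hf : HasTwoJet f p s) (hm : IsLocalMax f 0) : s ≤ 0 := by
  obtain ⟨f', h1, rfl, h3⟩ := hf
  by_contra! hs
  have he : deriv f =ᶠ[𝓝 0] f' := by filter_upwards [h1] with t h using h.deriv
  have hmin : IsLocalMin f 0 :=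
    isLocalMin_of_deriv_deriv_pos (by rw [he.deriv_eq, h3.deriv]; exact hs) hm.deriv_eq_zero
      h1.self_of_nhds.continuousAt
  have hc : f =ᶠ[𝓝 0] fun _ => f 0 := by
    filter_upwards [hm, hmin] with t a b using le_antisymm a b
  have hz : f' =ᶠ[𝓝 0] fun _ => 0 := by
    filter_upwards [he, hc.eventuallyEq_nhds] with t a b
    rw [← a, b.deriv_eq, deriv_const]
  have := hz.deriv_eq
  rw [h3.deriv, deriv_const] at this
  exact hs.ne' this

end HasTwoJet

lemma hasDerivAt_comp_line {h : ℂ → ℂ} (hh : Differentiable ℂ h) (z e : ℂ) (t : ℝ) :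
    HasDerivAt (fun t : ℝ => h (z + t * e)) (deriv h (z + t * e) * e) t := by
  have h1 : HasDerivAt (fun w : ℂ => z + w * e) e (t : ℂ) := by
    simpa using ((hasDerivAt_id (t : ℂ)).mul_const e).const_add z
  exact ((hh _).hasDerivAt.comp (t : ℂ) h1).comp_ofReal

lemma hasDerivAt_re_conj_mul {a b : ℝ → ℂ} {a' b' : ℂ} {t : ℝ} (ha : HasDerivAt a a' t)
    (hb : HasDerivAt b b' t) :
    HasDerivAt (fun t => (conj (a t) * b t).re) ((conj a' * b t).re + (conj (a t) * b').re) t := by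
  have h1 : HasDerivAt (fun t => conj (a t)) (conj a') t := by
    exact (conjCLE : ℂ ≃L[ℝ] ℂ).hasFDerivAt.comp_hasDerivAt t ha
  rw [← add_re]
  exact reCLM.hasFDerivAt.comp_hasDerivAt t (h1.mul hb)

/-- The second order expansion of `|h|²` along the line through `z` in direction `e`. -/
lemma hasTwoJet_normSq {h : ℂ → ℂ} (hh : Differentiable ℂ h) (z e : ℂ) :
    HasTwoJet (fun t => normSq (h (z + t * e))) (2 * (conj (h z) * (deriv h z * e)).re)
      (2 * (normSq (deriv h z * e) + (conj (h z) * (deriv (deriv h) z * e * e)).re)) := by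
  have hd : Differentiable ℂ (deriv h) := hh.deriv
  refine ⟨fun t => 2 * (conj (h (z + t * e)) * (deriv h (z + t * e) * e)).re,
    Eventually.of_forall fun t => ?_, by simp, ?_⟩
  · have h1 := hasDerivAt_re_conj_mul (hasDerivAt_comp_line hh z e t)
      (hasDerivAt_comp_line hh z e t)
    convert h1 using 1
    · funext t
      simp [normSq_apply]
    · dsimp only
      generalize deriv h (z + t * e) * e = u
      generalize h (z + t * e) = y
      simp only [mul_re, conj_re, conj_im]
      ring
  · have h1 := (hasDerivAt_re_conj_mul (hasDerivAt_comp_line hh z e 0)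
      ((hasDerivAt_comp_line hd z e 0).mul_const e)).const_mul 2
    exact h1.congr_deriv (by
      simp [normSq_apply]
      ring)

/-- The key pointwise estimate: the Laplacian of
`2 log (R² - |z|²) + log |g|² + log (1 + |α|² + |β|²)` is nonpositive at a local maximum. -/
lemma normSq_deriv_le_of_isLocalMax {α β g : ℂ → ℂ} (hα : Differentiable ℂ α)
    (hβ : Differentiable ℂ β) (hg : Differentiable ℂ g) {R : ℝ} {z : ℂ}
    (hz : normSq z < R ^ 2) (hgz : g z ≠ 0)
    (hmax : IsLocalMax (fun z => 2 * Real.log (R ^ 2 + -1 * normSq z) + Real.log (normSq (g z)) +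
      Real.log (1 + (normSq (α z) + normSq (β z)))) z) :
    (normSq (deriv α z) + normSq (deriv β z)) * (R ^ 2 - normSq z) ^ 2 ≤
      2 * R ^ 2 * (1 + (normSq (α z) + normSq (β z))) ^ 2 := by
  have hw : 0 < R ^ 2 + -1 * normSq z := by linarith
  have hG : 0 < normSq (g z) := normSq_pos.2 hgz
  have hv : 0 < 1 + (normSq (α z) + normSq (β z)) := by
    have := normSq_nonneg (α z); have := normSq_nonneg (β z); linarith
  have key (e : ℂ) := by
    have j1 := (((hasTwoJet_normSq differentiable_id z e).const_mul (-1)).const_add (R ^ 2)).log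
      (by simpa using hw.ne')
    have j2 := (hasTwoJet_normSq hg z e).log (by simpa using hG.ne')
    have j3 := (((hasTwoJet_normSq hα z e).add (hasTwoJet_normSq hβ z e)).const_add 1).log
      (by simpa using hv.ne')
    refine (((j1.const_mul 2).add j2).add j3).nonpos_of_isLocalMax ?_
    have hcont : Tendsto (fun t : ℝ => z + t * e) (𝓝 0) (𝓝 z) := by
      have : Continuous fun t : ℝ => z + t * e := by fun_prop
      simpa using this.tendsto 0
    have := hcont.eventually hmax
    filter_upwards [this] with t ht
    simpa using ht
  have hsum : 2 * (-4 / (R ^ 2 + -1 * normSq z) - 4 * normSq z / (R ^ 2 + -1 * normSq z) ^ 2) +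
      (4 * normSq (deriv g z) / normSq (g z) -
        4 * (normSq (g z) * normSq (deriv g z)) / normSq (g z) ^ 2) +
      (4 * (normSq (deriv α z) + normSq (deriv β z)) / (1 + (normSq (α z) + normSq (β z))) -
        4 * normSq (conj (α z) * deriv α z + conj (β z) * deriv β z) /
          (1 + (normSq (α z) + normSq (β z))) ^ 2) ≤ 0 := by
    have k := add_nonpos (key 1) (key I)
    simp only [ofReal_zero, zero_mul, add_zero, id, deriv_id', mul_one, one_mul,
      deriv_const', div_eq_mul_inv, ← inv_pow] at k ⊢
    generalize (R ^ 2 + -1 * normSq z)⁻¹ = W at k ⊢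
    generalize (normSq (g z))⁻¹ = G at k ⊢
    generalize (1 + (normSq (α z) + normSq (β z)))⁻¹ = V at k ⊢
    simp only [normSq_apply, mul_re, mul_im, add_re, add_im, conj_re, conj_im, I_re, I_im, one_re,
      one_im, zero_re, zero_im] at k ⊢
    linarith
  have hcs : normSq (deriv α z) + normSq (deriv β z) +
      normSq (conj (α z) * deriv α z + conj (β z) * deriv β z) ≤
      (normSq (deriv α z) + normSq (deriv β z)) * (1 + (normSq (α z) + normSq (β z))) := by
    have := normSq_nonneg (α z * deriv β z - β z * deriv α z)
    simp only [normSq_apply, mul_re, mul_im, add_re, add_im, sub_re, sub_im, conj_re,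
      conj_im] at this ⊢
    linarith
  have hR : R ^ 2 - normSq z = R ^ 2 + -1 * normSq z := by ring
  rw [hR]
  have hzw : normSq z = R ^ 2 - (R ^ 2 + -1 * normSq z) := by ring
  generalize R ^ 2 + -1 * normSq z = w at *
  generalize 1 + (normSq (α z) + normSq (β z)) = v at *
  generalize normSq (conj (α z) * deriv α z + conj (β z) * deriv β z) = s at *
  generalize normSq (deriv α z) + normSq (deriv β z) = P at *
  rw [hzw] at hsum
  have e1 : 2 * (-4 / w - 4 * (R ^ 2 - w) / w ^ 2) + (4 * normSq (deriv g z) / normSq (g z) -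
        4 * (normSq (g z) * normSq (deriv g z)) / normSq (g z) ^ 2) +
      (4 * P / v - 4 * s / v ^ 2) = 4 * ((P * v - s) / v ^ 2 - 2 * R ^ 2 / w ^ 2) := by
    field_simp
    ring
  rw [e1] at hsum
  have h2 : P / v ^ 2 ≤ 2 * R ^ 2 / w ^ 2 := by
    have : P / v ^ 2 ≤ (P * v - s) / v ^ 2 := by gcongr; linarith
    linarith
  rwa [div_le_div_iff₀ (by positivity) (by positivity)] at h2

/-- An Ahlfors-Schwarz lemma for the metric `|g|² (1 + |α|² + |β|²)` of curvature bounded above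
by a negative constant. -/
lemma eq_zero_of_le_normSq_deriv {α β g : ℂ → ℂ} (hα : Differentiable ℂ α)
    (hβ : Differentiable ℂ β) (hg : Differentiable ℂ g) {δ : ℝ} (hδ : 0 < δ)
    (hle : ∀ z, δ * normSq (g z) * (1 + (normSq (α z) + normSq (β z))) ^ 3 ≤
      normSq (deriv α z) + normSq (deriv β z)) : g 0 = 0 := by
  have hv (z : ℂ) : 0 < 1 + (normSq (α z) + normSq (β z)) := by
    have := normSq_nonneg (α z); have := normSq_nonneg (β z); linarith
  set u : ℂ → ℝ := fun z => normSq (g z) * (1 + (normSq (α z) + normSq (β z))) with hu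
  have hbound (R : ℝ) (hR : 0 < R) : u 0 * δ * R ^ 2 ≤ 2 := by
    set F : ℂ → ℝ := fun z => (R ^ 2 - normSq z) ^ 2 * u z with hF
    have hFc : Continuous F := by
      have := hα.continuous
      have := hβ.continuous
      have := hg.continuous
      have := continuous_normSq
      fun_prop
    obtain ⟨z, hzR, hzmax⟩ := (isCompact_closedBall (0 : ℂ) R).exists_isMaxOn
      ⟨0, by simp [hR.le]⟩ hFc.continuousOn
    have hF0 : F 0 ≤ F z := hzmax (by simp [hR.le])
    have hF0' : F 0 = R ^ 4 * u 0 := by simp only [hF, map_zero]; ring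
    suffices δ * F z ≤ 2 * R ^ 2 by
      have h1 : R ^ 2 * (u 0 * δ * R ^ 2) ≤ R ^ 2 * 2 := by
        have := mul_le_mul_of_nonneg_left hF0 hδ.le
        rw [hF0'] at this
        linarith
      exact le_of_mul_le_mul_left h1 (by positivity)
    rcases eq_or_ne (F z) 0 with h0 | h0
    · rw [h0, mul_zero]; positivity
    have hgz : g z ≠ 0 := by
      rintro h
      simp [hF, hu, h] at h0
    have hzlt : normSq z < R ^ 2 := by
      have h1 : normSq z ≤ R ^ 2 := by
        rw [normSq_eq_norm_sq]
        gcongr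
        simpa using hzR
      refine h1.lt_of_ne fun h => h0 ?_
      simp [hF, h]
    have hnear : ∀ᶠ y in 𝓝 z, normSq y < R ^ 2 :=
      (continuous_normSq.tendsto z).eventually_lt_const hzlt
    have hlogF (y : ℂ) (hy : normSq y < R ^ 2) (hgy : g y ≠ 0) :
        2 * Real.log (R ^ 2 + -1 * normSq y) + Real.log (normSq (g y)) +
          Real.log (1 + (normSq (α y) + normSq (β y))) = Real.log (F y) := by
      have hy' : R ^ 2 - normSq y ≠ 0 := by linarith
      have hgy' : normSq (g y) ≠ 0 := (normSq_pos.2 hgy).ne'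
      simp only [hF, hu]
      rw [Real.log_mul (by positivity) (mul_ne_zero hgy' (hv y).ne'),
        Real.log_mul hgy' (hv y).ne', Real.log_pow]
      push_cast
      ring_nf
    have key := normSq_deriv_le_of_isLocalMax hα hβ hg hzlt hgz (by
      filter_upwards [hnear, hg.continuous.continuousAt.eventually_ne hgz] with y hy hgy
      rw [hlogF y hy hgy, hlogF z hzlt hgz]
      have hy' : 0 < R ^ 2 - normSq y := by linarith
      have hFy : 0 < F y := mul_pos (by positivity) (mul_pos (normSq_pos.2 hgy) (hv y))
      refine Real.log_le_log hFy (hzmax ?_)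
      rw [normSq_eq_norm_sq] at hy
      simpa using (lt_of_pow_lt_pow_left₀ 2 hR.le hy).le)
    have h2 := (mul_le_mul_of_nonneg_right (hle z) (sq_nonneg (R ^ 2 - normSq z))).trans key
    refine le_of_mul_le_mul_right ?_ (pow_pos (hv z) 2)
    refine le_of_eq_of_le ?_ h2
    simp only [hF, hu]
    ring
  by_contra hne
  have hpos : 0 < u 0 * δ := mul_pos (mul_pos (normSq_pos.2 hne) (hv 0)) hδ
  have h3 := hbound (1 + 2 / (u 0 * δ)) (by positivity)
  have h4 : u 0 * δ * (1 + 2 / (u 0 * δ)) = u 0 * δ + 2 := by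
    rw [mul_add, mul_one, mul_div_cancel₀ _ hpos.ne']
  have h5 : 1 ≤ 1 + 2 / (u 0 * δ) := by
    have : 0 < 2 / (u 0 * δ) := by positivity
    linarith
  nlinarith

lemma mul_one_add_cube_le_pow {ε m x y : ℝ} {k K : ℕ} (hε : 0 < ε) (hε1 : ε ≤ 1) (hm : ε ≤ m)
    (hx : 0 ≤ x) (hy : 0 ≤ y) (hxm : x ≤ m) (hym : y ≤ m) (hk : 3 ≤ k) (hkK : k ≤ K) :
    ε ^ K / 27 * (1 + (x + y)) ^ 3 ≤ m ^ k := by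
  rcases le_total 1 m with h | h
  · calc ε ^ K / 27 * (1 + (x + y)) ^ 3 ≤ 1 / 27 * (3 * m) ^ 3 := by
          gcongr
          · exact pow_le_one₀ hε.le hε1
          · linarith
      _ = m ^ 3 := by ring
      _ ≤ m ^ k := pow_le_pow_right₀ h hk
  · calc ε ^ K / 27 * (1 + (x + y)) ^ 3 ≤ ε ^ K / 27 * 3 ^ 3 := by
          gcongr
          linarith
      _ = ε ^ K := by ring
      _ ≤ ε ^ k := pow_le_pow_of_le_one hε.le hε1 hkK
      _ ≤ m ^ k := by gcongr

/-- On the affine curve `a ^ N - b ^ M = c`, away from the origin, the top powers of the coordinates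
control `(1 + |a|² + |b|²) ^ 3`. -/
lemma exists_mul_one_add_cube_le {N M : ℕ} (hN : 4 ≤ N) (hM : 4 ≤ M) {c : ℂ} (hc : c ≠ 0) :
    ∃ δ : ℝ, 0 < δ ∧ ∀ a b : ℂ, a ^ N - b ^ M = c →
      δ * (1 + (normSq a + normSq b)) ^ 3 ≤ normSq a ^ (N - 1) + normSq b ^ (M - 1) := by
  set ε : ℝ := min 1 (‖c‖ / 2)
  have hε : 0 < ε := lt_min one_pos (by positivity)
  have hε1 : ε ≤ 1 := min_le_left _ _
  refine ⟨(ε ^ 2) ^ (N + M) / 27, by positivity, fun a b h => ?_⟩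
  have hmax : ε ≤ max ‖a‖ ‖b‖ := by
    by_contra! hlt
    obtain ⟨ha, hb⟩ := max_lt_iff.1 hlt
    have ha' : ‖a‖ ^ N ≤ ‖a‖ := pow_le_of_le_one (norm_nonneg _) (ha.le.trans hε1) (by lia)
    have hb' : ‖b‖ ^ M ≤ ‖b‖ := pow_le_of_le_one (norm_nonneg _) (hb.le.trans hε1) (by lia)
    have hc' : ‖c‖ ≤ ‖a‖ ^ N + ‖b‖ ^ M := by
      rw [← h, ← norm_pow, ← norm_pow]
      exact norm_sub_le _ _
    have : ε ≤ ‖c‖ / 2 := min_le_right _ _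
    linarith
  have hε2 : ε ^ 2 ≤ 1 := pow_le_one₀ hε.le hε1
  have na := normSq_nonneg a
  have nb := normSq_nonneg b
  rcases le_total ‖a‖ ‖b‖ with hab | hab
  · rw [max_eq_right hab] at hmax
    have := mul_one_add_cube_le_pow (k := M - 1) (K := N + M) (pow_pos hε 2) hε2
      (m := normSq b) (x := normSq a) (y := normSq b)
      (by rw [normSq_eq_norm_sq]; gcongr) na nb
      (by rw [normSq_eq_norm_sq, normSq_eq_norm_sq]; gcongr) le_rfl (by lia) (by lia)
    exact this.trans (le_add_of_nonneg_left (pow_nonneg na _))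
  · rw [max_eq_left hab] at hmax
    have := mul_one_add_cube_le_pow (k := N - 1) (K := N + M) (pow_pos hε 2) hε2
      (m := normSq a) (x := normSq a) (y := normSq b)
      (by rw [normSq_eq_norm_sq]; gcongr) na nb le_rfl
      (by rw [normSq_eq_norm_sq, normSq_eq_norm_sq]; gcongr) (by lia) (by lia)
    exact this.trans (le_add_of_nonneg_right (pow_nonneg nb _))

lemma deriv_zero_eq_zero_of_pow_sub_pow_eq {N M : ℕ} (hN : 4 ≤ N) (hM : 4 ≤ M) {α β : ℂ → ℂ}
    (hα : Differentiable ℂ α) (hβ : Differentiable ℂ β) {c : ℂ} (hc : c ≠ 0)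
    (heq : ∀ z : ℂ, α z ^ N - β z ^ M = c) : deriv α 0 = 0 ∧ deriv β 0 = 0 := by
  have hN0 : (N : ℂ) ≠ 0 := by norm_cast; lia
  have hM0 : (M : ℂ) ≠ 0 := by norm_cast; lia
  have hd (z : ℂ) : N * α z ^ (N - 1) * deriv α z = M * β z ^ (M - 1) * deriv β z := by
    have h1 := ((hα z).hasDerivAt.pow N).sub ((hβ z).hasDerivAt.pow M)
    have h2 : α ^ N - β ^ M = fun _ => c := funext heq
    rw [h2] at h1
    exact sub_eq_zero.1 (h1.unique (hasDerivAt_const z c))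
  have hpa (z : ℂ) : α z ^ N = α z ^ (N - 1) * α z := by rw [← pow_succ]; congr 1; lia
  have hpb (z : ℂ) : β z ^ M = β z ^ (M - 1) * β z := by rw [← pow_succ]; congr 1; lia
  set g : ℂ → ℂ := fun z => (M * (α z * deriv β z) - N * (β z * deriv α z)) / c with hgdef
  have hg : Differentiable ℂ g := by
    have := hα.deriv
    have := hβ.deriv
    fun_prop
  have hαg (z : ℂ) : N * deriv α z = β z ^ (M - 1) * g z := by
    have h1 := heq z
    rw [hpa, hpb] at h1
    simp only [hgdef]
    field_simp
    linear_combination (-N * deriv α z) * h1 + α z * hd z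
  have hβg (z : ℂ) : M * deriv β z = α z ^ (N - 1) * g z := by
    have h1 := heq z
    rw [hpa, hpb] at h1
    simp only [hgdef]
    field_simp
    linear_combination (-M * deriv β z) * h1 + β z * hd z
  obtain ⟨δ, hδ, hle⟩ := exists_mul_one_add_cube_le hN hM hc
  have hN1 : (0 : ℝ) < N := by norm_cast; lia
  have hM1 : (0 : ℝ) < M := by norm_cast; lia
  have hg0 : g 0 = 0 := by
    refine eq_zero_of_le_normSq_deriv (δ := δ / (N * M) ^ 2) hα hβ hg (by positivity) fun z => ?_
    have h1 := congrArg normSq (hαg z)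
    have h2 := congrArg normSq (hβg z)
    simp only [map_mul, map_pow, normSq_natCast] at h1 h2
    have h3 := mul_le_mul_of_nonneg_right (hle _ _ (heq z)) (normSq_nonneg (g z))
    have hN2 : (1 : ℝ) ≤ N := by norm_cast; lia
    have hM2 : (1 : ℝ) ≤ M := by norm_cast; lia
    have hNM : (N : ℝ) ^ 2 ≤ (N * M) ^ 2 := by
      gcongr
      exact le_mul_of_one_le_right hN1.le hM2
    have hMN : (M : ℝ) ^ 2 ≤ (N * M) ^ 2 := by
      gcongr
      exact le_mul_of_one_le_left hM1.le hN2
    have h4 := mul_le_mul_of_nonneg_right hNM (normSq_nonneg (deriv α z))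
    have h5 := mul_le_mul_of_nonneg_right hMN (normSq_nonneg (deriv β z))
    rw [div_mul_eq_mul_div, div_mul_eq_mul_div, div_le_iff₀ (by positivity)]
    linarith
  have h1 := hαg 0
  have h2 := hβg 0
  rw [hg0, mul_zero] at h1 h2
  exact ⟨(mul_eq_zero.1 h1).resolve_left hN0, (mul_eq_zero.1 h2).resolve_left hM0⟩

/-- (Fermat-type theorem for entire functions) If `α, β : ℂ → ℂ` are entire and satisfy
`α^N − β^M = c` with `c ≠ 0` and `N, M ≥ 4`, then `α` and `β` are both constant; i.e.
there are no such nonconstant entire solutions. -/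
theorem no_nonconstant_entire_fermat (N M : ℕ) (hN : 4 ≤ N) (hM : 4 ≤ M)
    (α β : ℂ → ℂ) (hα : Differentiable ℂ α) (hβ : Differentiable ℂ β)
    (c : ℂ) (hc : c ≠ 0) (heq : ∀ z : ℂ, α z ^ N - β z ^ M = c) :
    (∀ z w : ℂ, α z = α w) ∧ (∀ z w : ℂ, β z = β w) := by
  have h (z : ℂ) : deriv α z = 0 ∧ deriv β z = 0 := by
    have := deriv_zero_eq_zero_of_pow_sub_pow_eq hN hM (α := fun w => α (w + z))
      (β := fun w => β (w + z)) (by fun_prop) (by fun_prop) hc fun w => heq (w + z)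
    simpa [deriv_comp_add_const] using this
  exact ⟨is_const_of_deriv_eq_zero hα fun z => (h z).1,
    is_const_of_deriv_eq_zero hβ fun z => (h z).2⟩
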